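/- If n ≥ 3, then every nontrivial finite quotient of SL_n(ℤ) has cardinality at least |PSL_n(ℤ/2ℤ)|; in particular, any homomorphism from SL_n(ℤ) to a finite group of order less than |PSL_n(ℤ/2ℤ)| is trivial. -/

import Mathlib

open Matrix

namespace SLQ

abbrev tv {ι R : Type*} [DecidableEq ι] [Fintype ι] [CommRing R] {i j : ι} (h : i ≠ j) (c : R) :
    SpecialLinearGroup ι R := SpecialLinearGroup.transvection h c

lemma val_mul {ι R : Type*} [DecidableEq ι] [Fintype ι] [CommRing R]
    (A B : SpecialLinearGroup ι R) : (A * B).1 = A.1 * B.1 := rfl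

lemma val_one {ι R : Type*} [DecidableEq ι] [Fintype ι] [CommRing R] :
    (1 : SpecialLinearGroup ι R).1 = 1 := rfl

section gen
variable {ι R : Type*} [DecidableEq ι] [Fintype ι] [CommRing R]

lemma tv_same {i j : ι} (h : i ≠ j) (c : R) (g : SpecialLinearGroup ι R) (b : ι) :
    (tv h c * g) i b = g i b + c * g j b := by
  change (Matrix.transvection i j c * g.1) i b = _
  simp

lemma tv_ne {i j : ι} (h : i ≠ j) (c : R) (g : SpecialLinearGroup ι R) (a b : ι) (ha : a ≠ i) :
    (tv h c * g) a b = g a b := by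
  change (Matrix.transvection i j c * g.1) a b = _
  simp [ha]

/-- The columns of `g` indexed by `S` are standard. -/
def Fx (S : Finset ι) (g : SpecialLinearGroup ι R) : Prop :=
  ∀ s ∈ S, ∀ i, g i s = if i = s then 1 else 0

lemma Fx.tv {S : Finset ι} {g : SpecialLinearGroup ι R} (hg : Fx S g) {i j : ι} (h : i ≠ j)
    (hj : j ∉ S) (c : R) : Fx S (tv h c * g) := by
  intro s hs a
  by_cases ha : a = i
  · subst ha
    have : j ≠ s := fun e => hj (e ▸ hs)
    rw [tv_same, hg s hs, hg s hs, if_neg this]; simp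
  · rw [tv_ne _ _ _ _ _ ha, hg s hs]

def PP (E : Subgroup (SpecialLinearGroup ι R)) (S : Finset ι) (g : SpecialLinearGroup ι R) : Prop :=
  ∃ h ∈ E, Fx S (h * g)

variable {E : Subgroup (SpecialLinearGroup ι R)}

lemma PP.of_tv (hE : ∀ (i j : ι) (h : i ≠ j) (c : R), tv h c ∈ E) {S : Finset ι}
    {g : SpecialLinearGroup ι R} {i j : ι} (h : i ≠ j) (c : R) (hp : PP E S (tv h c * g)) :
    PP E S g := by
  obtain ⟨x, hx, hf⟩ := hp
  exact ⟨x * SLQ.tv h c, E.mul_mem hx (hE _ _ _ _), by rwa [mul_assoc]⟩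

lemma stepC (hE : ∀ (i j : ι) (h : i ≠ j) (c : R), tv h c ∈ E) (S : Finset ι) (k : ι)
    (hk : k ∉ S) (T : Finset ι) : ∀ g : SpecialLinearGroup ι R, Fx S g → g k k = 1 →
    (∀ i, i ∉ T → i ≠ k → g i k = 0) → PP E (insert k S) g := by
  induction T using Finset.induction_on with
  | empty =>
    intro g hg h1 h0
    refine ⟨1, E.one_mem, ?_⟩
    rw [one_mul]
    intro s hs i
    rcases Finset.mem_insert.1 hs with rfl | hs
    · by_cases h : i = s
      · subst h; simp [h1]
      · simp [h, h0]
    · exact hg s hs i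
  | insert a T ha ih =>
    intro g hg h1 h0
    by_cases hak : a = k
    · apply ih g hg h1
      intro i hi hik
      exact h0 i (by simp [hi, hak, hik]) hik
    · apply PP.of_tv hE hak (- g a k)
      apply ih _ (hg.tv _ hk _)
      · rw [tv_ne _ _ _ _ _ (Ne.symm hak), h1]
      · intro i hi hik
        by_cases hia : i = a
        · subst hia; rw [tv_same, h1]; ring
        · rw [tv_ne _ _ _ _ _ hia]; exact h0 i (by simp [hi, hia]) hik

lemma stepC' (hE : ∀ (i j : ι) (h : i ≠ j) (c : R), tv h c ∈ E) (S : Finset ι) (k : ι)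
    (hk : k ∉ S) (g : SpecialLinearGroup ι R) (hg : Fx S g) (h1 : g k k = 1) :
    PP E (insert k S) g :=
  stepC hE S k hk Finset.univ g hg h1 (by simp)

lemma stepB1 (hE : ∀ (i j : ι) (h : i ≠ j) (c : R), tv h c ∈ E) (S : Finset ι) (k : ι)
    (hk : k ∉ S) (g : SpecialLinearGroup ι R) (hg : Fx S g) (j : ι) (hj : j ∉ S) (hjk : j ≠ k)
    (hu : IsUnit (g j k)) : PP E (insert k S) g := by
  obtain ⟨c, hc⟩ := hu.exists_left_inv
  apply PP.of_tv hE hjk.symm ((1 - g k k) * c)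
  apply stepC' hE S k hk _ (hg.tv _ hj _)
  rw [tv_same, mul_assoc, hc]; ring

lemma stepB (hE : ∀ (i j : ι) (h : i ≠ j) (c : R), tv h c ∈ E) (S : Finset ι) (k : ι)
    (hk : k ∉ S) (g : SpecialLinearGroup ι R) (hg : Fx S g) (j : ι) (hj : j ∉ S)
    (hu : IsUnit (g j k)) : PP E (insert k S) g := by
  by_cases hjk : j = k
  · subst hjk
    by_cases hex : ∃ i, i ∉ S ∧ i ≠ j
    · obtain ⟨i, hi, hij⟩ := hex
      obtain ⟨c, hc⟩ := hu.exists_left_inv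
      apply PP.of_tv hE hij ((1 - g i j) * c)
      apply stepB1 hE S j hk _ (hg.tv _ hj _) i hi hij
      rw [tv_same, mul_assoc, hc]
      simp
    · push Not at hex
      apply stepC' hE S j hk g hg
      have e : g.1 = (1 : Matrix ι ι R).updateCol j (fun i => g i j) := by
        ext a b
        by_cases hb : b = j
        · subst hb; simp
        · have hbS : b ∈ S := by by_contra h; exact hb (hex b h)
          rw [updateCol_ne hb]
          exact (hg b hbS a).trans (by simp [one_apply])
      have hd := g.2
      rw [e, ← cramer_apply, cramer_one] at hd
      exact hd
  · exact stepB1 hE S k hk g hg j hj hjk hu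

lemma stepA [Nontrivial R] (δ : R → ℕ) (hδ : ∀ a : R, a ≠ 0 → ∀ b, ∃ q, δ (b + q * a) < δ a)
    (hE : ∀ (i j : ι) (h : i ≠ j) (c : R), tv h c ∈ E) (S : Finset ι) (k : ι)
    (hk : k ∉ S) (N : ℕ) : ∀ (g : SpecialLinearGroup ι R), Fx S g →
    ∑ i ∈ Sᶜ, δ (g i k) = N → PP E (insert k S) g := by
  induction N using Nat.strong_induction_on with
  | _ N ih =>
  intro g hg hN
  by_cases hex : ∃ i j, i ∉ S ∧ j ∉ S ∧ i ≠ j ∧ g i k ≠ 0 ∧ δ (g i k) ≤ δ (g j k)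
  · obtain ⟨i, j, hi, hj, hij, h0, hle⟩ := hex
    obtain ⟨q, hq⟩ := hδ _ h0 (g j k)
    apply PP.of_tv hE hij.symm q
    refine ih _ ?_ _ (hg.tv _ hi _) rfl
    rw [← hN]
    apply Finset.sum_lt_sum
    · intro a _
      by_cases ha : a = j
      · subst ha; rw [tv_same]; omega
      · rw [tv_ne _ _ _ _ _ ha]
    · refine ⟨j, by simpa using hj, ?_⟩
      rw [tv_same]; omega
  · push Not at hex
    have hinv : g⁻¹.1 * g.1 = 1 := by
      rw [← val_mul, inv_mul_cancel, val_one]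
    have hz : ∀ s ∈ S, g⁻¹.1 k s = 0 := by
      intro s hs
      have h1 := congrFun (congrFun hinv k) s
      rw [mul_apply] at h1
      have : ∀ i, g.1 i s = if i = s then 1 else 0 := hg s hs
      simp only [this] at h1
      have hks : k ≠ s := fun e => hk (e ▸ hs)
      simpa [one_apply, hks] using h1
    have h1 := congrFun (congrFun hinv k) k
    rw [mul_apply, one_apply_eq] at h1
    obtain ⟨i, hi, hi0⟩ : ∃ i, i ∉ S ∧ g i k ≠ 0 := by
      by_contra hcon
      push Not at hcon
      rw [Finset.sum_eq_zero] at h1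
      · exact zero_ne_one h1
      · intro x _
        by_cases hx : x ∈ S
        · rw [hz x hx, zero_mul]
        · rw [show g.1 x k = 0 from hcon x hx, mul_zero]
    rw [Finset.sum_eq_single i] at h1
    · exact stepB hE S k hk g hg i hi (IsUnit.of_mul_eq_one_right _ h1)
    · intro j _ hji
      by_cases hx : j ∈ S
      · rw [hz j hx, zero_mul]
      · have : g.1 j k = 0 := by
          by_contra hj0
          have a1 := hex i j hi hx hji.symm hi0
          have a2 := hex j i hx hi hji hj0
          omega
        rw [this, mul_zero]
    · simp

theorem gen [Nontrivial R] (δ : R → ℕ) (hδ : ∀ a : R, a ≠ 0 → ∀ b, ∃ q, δ (b + q * a) < δ a)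
    (hE : ∀ (i j : ι) (h : i ≠ j) (c : R), tv h c ∈ E) : E = ⊤ := by
  rw [eq_top_iff]
  intro g _
  have key : ∀ S : Finset ι, PP E S g := by
    intro S
    induction S using Finset.induction_on with
    | empty => exact ⟨1, E.one_mem, by intro s hs; simp at hs⟩
    | insert k S hk ih =>
      obtain ⟨h, hh, hf⟩ := ih
      obtain ⟨h', hh', hf'⟩ := stepA δ hδ hE S k hk _ _ hf rfl
      exact ⟨h' * h, E.mul_mem hh' hh, by rwa [mul_assoc]⟩
  obtain ⟨h, hh, hf⟩ := key Finset.univ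
  have : h * g = 1 := by
    ext i j
    rw [hf j (Finset.mem_univ _) i]
    simp [one_apply]
  rw [eq_inv_of_mul_eq_one_right this]
  exact E.inv_mem hh

theorem gen_int {E : Subgroup (SpecialLinearGroup ι ℤ)}
    (hE : ∀ (i j : ι) (h : i ≠ j) (c : ℤ), tv h c ∈ E) : E = ⊤ := by
  refine gen Int.natAbs ?_ hE
  intro a ha b
  refine ⟨-(b / a), ?_⟩
  have h1 := Int.emod_nonneg b ha
  have h2 := Int.emod_lt_abs b ha
  have : b + -(b / a) * a = b % a := by
    have := Int.emod_add_mul_ediv b a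
    linarith
  rw [this]
  zify
  rwa [abs_of_nonneg h1]

theorem gen_field {F : Type*} [Field F] {E : Subgroup (SpecialLinearGroup ι F)}
    (hE : ∀ (i j : ι) (h : i ≠ j) (c : F), tv h c ∈ E) : E = ⊤ := by
  classical
  refine gen (fun x => if x = 0 then 0 else 1) ?_ hE
  intro a ha b
  refine ⟨-b / a, ?_⟩
  have : b + -b / a * a = 0 := by field_simp; ring
  simp [ha]

end gen

section sandwich
variable {ι R : Type*} [DecidableEq ι] [Fintype ι] [CommRing R]

/-- General transvection `1 + u w`. -/
def TT (u w : ι → R) (h : w ⬝ᵥ u = 0) : SpecialLinearGroup ι R :=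
  ⟨1 + vecMulVec u w, by
    rw [vecMulVec_eq Unit, det_one_add_replicateCol_mul_replicateRow, h, add_zero]⟩

lemma TT_coe (u w : ι → R) (h : w ⬝ᵥ u = 0) : (TT u w h).1 = 1 + vecMulVec u w := rfl

lemma TT_mulVec (u w : ι → R) (h : w ⬝ᵥ u = 0) (x : ι → R) :
    (TT u w h).1 *ᵥ x = x + (w ⬝ᵥ x) • u := by
  rw [TT_coe, add_mulVec, one_mulVec, vecMulVec_mulVec]; simp

lemma vecMul_TT (u w : ι → R) (h : w ⬝ᵥ u = 0) (x : ι → R) :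
    x ᵥ* (TT u w h).1 = x + (x ⬝ᵥ u) • w := by
  rw [TT_coe, vecMul_add, vecMul_one, vecMul_vecMulVec]

lemma TT_mul_left (u w w' : ι → R) (h : w ⬝ᵥ u = 0) (h' : w' ⬝ᵥ u = 0) :
    TT u w h * TT u w' h' = TT u (w + w') (by rw [add_dotProduct, h, h', add_zero]) := by
  apply Subtype.ext
  rw [val_mul, TT_coe, TT_coe, TT_coe, add_mul, one_mul, mul_add, mul_one,
    vecMulVec_mul_vecMulVec, h, zero_smul, vecMulVec_add]
  simp
  abel

lemma inv_mul_coe (g : SpecialLinearGroup ι R) : g⁻¹.1 * g.1 = 1 := by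
  rw [← val_mul, inv_mul_cancel, val_one]

lemma mul_inv_coe (g : SpecialLinearGroup ι R) : g.1 * g⁻¹.1 = 1 := by
  rw [← val_mul, mul_inv_cancel, val_one]

lemma TT_conj (g : SpecialLinearGroup ι R) (u w : ι → R) (h : w ⬝ᵥ u = 0) :
    g⁻¹ * TT u w h * g = TT (g⁻¹.1 *ᵥ u) (w ᵥ* g.1) (by
      rw [← dotProduct_mulVec, mulVec_mulVec, mul_inv_coe, one_mulVec, h]) := by
  apply Subtype.ext
  rw [val_mul, val_mul, TT_coe, TT_coe, mul_add, add_mul,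
    mul_one, inv_mul_coe, mul_vecMulVec, vecMulVec_mul]

lemma tv_eq {i j : ι} (h : i ≠ j) (c : R) :
    tv h c = TT (Pi.single i 1) (Pi.single j c) (by simp [h.symm]) := by
  apply Subtype.ext
  rw [TT_coe]
  change (1 : Matrix ι ι R) + single i j c = _
  congr 1
  ext a b
  simp only [single_apply, vecMulVec_apply, Pi.single_apply]
  by_cases h1 : i = a <;> by_cases h2 : j = b <;> simp [h1, h2, eq_comm]

lemma TT_congr {u w u' w' : ι → R} (hu : u = u') (hw : w = w') (h : w ⬝ᵥ u = 0) :
    TT u w h = TT u' w' (by rw [← hu, ← hw, h]) := by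
  subst hu; subst hw; rfl

variable {N : Subgroup (SpecialLinearGroup ι R)} [N.Normal]

/-- Row extraction. -/
lemma L1 (a j k : ι) (r : ι → R) (hr : r ⬝ᵥ (Pi.single a 1) = 0) (hN : TT (Pi.single a 1) r hr ∈ N)
    (haj : a ≠ j) (hak : a ≠ k) (hjk : j ≠ k) : tv hak (r j) ∈ N := by
  have h1 : (tv hjk (1 : R))⁻¹ * TT (Pi.single a 1) r hr * tv hjk (1 : R) ∈ N := by
    simpa using (inferInstance : N.Normal).conj_mem _ hN (tv hjk (1 : R))⁻¹
  have h2 := N.mul_mem (N.inv_mem hN) h1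
  rw [TT_conj] at h2
  have e1 : (tv hjk (1 : R))⁻¹.1 *ᵥ (Pi.single a 1) = Pi.single a 1 := by
    rw [show (tv hjk (1 : R))⁻¹ = tv hjk (-1) from SpecialLinearGroup.transvection_inv hjk 1,
      tv_eq, TT_mulVec]
    simp [hak, hak.symm]
  have e2 : r ᵥ* (tv hjk (1 : R)).1 = r + Pi.single k (r j) := by
    rw [tv_eq, vecMul_TT]
    congr 1
    ext b
    simp [Pi.single_apply]
  have e3 := TT_congr e1 e2 (by
      rw [← dotProduct_mulVec, mulVec_mulVec, mul_inv_coe, one_mulVec, hr])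
  rw [e3] at h2
  have e4 : TT (Pi.single a 1) (r + Pi.single k (r j)) (by
      rw [add_dotProduct, hr]; simp [hak, hak.symm]) = TT (Pi.single a 1) r hr * tv hak (r j) := by
    rw [tv_eq, TT_mul_left]
  rw [e4] at h2
  simpa using h2

lemma mem_of_TT {i j k : ι} (hij : i ≠ j) (hik : i ≠ k) (hjk : j ≠ k) (c : R)
    (h : tv hij c ∈ N) : tv hik c ∈ N := by
  rw [tv_eq] at h
  simpa using L1 i j k _ _ h hij hik hjk

lemma L2 {i j k : ι} (hij : i ≠ j) (hkj : k ≠ j) (hik : i ≠ k) (c : R)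
    (h : tv hij c ∈ N) : tv hkj c ∈ N := by
  have h1 : tv hik.symm (1 : R) * tv hij c * (tv hik.symm (1 : R))⁻¹ ∈ N :=
    (inferInstance : N.Normal).conj_mem _ h (tv hik.symm (1 : R))
  have h2 := N.mul_mem h1 (N.inv_mem h)
  have e : tv hik.symm (1 : R) * tv hij c * (tv hik.symm (1 : R))⁻¹ * (tv hij c)⁻¹
      = tv hkj c := by
    rw [mul_inv_eq_iff_eq_mul, mul_inv_eq_iff_eq_mul]
    apply Subtype.ext
    simp only [val_mul]
    change (1 + single k i (1 : R)) * (1 + single i j c) =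
      (1 + single k j c) * (1 + single i j c) * (1 + single k i (1 : R))
    simp [mul_add, add_mul, hij, hij.symm, hkj, hkj.symm, hik, hik.symm]
    abel
  rwa [e] at h2

lemma exists_ne_ne (hι : 3 ≤ Fintype.card ι) (a b : ι) : ∃ c, c ≠ a ∧ c ≠ b := by
  have : ({a, b} : Finset ι).card < Fintype.card ι :=
    lt_of_le_of_lt (Finset.card_le_two) (by omega)
  obtain ⟨c, hc⟩ := Finset.exists_mem_notMem_of_card_lt_card
    (s := ({a, b} : Finset ι)) (t := Finset.univ) (by simpa using this)
  exact ⟨c, by simpa using hc.2⟩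

lemma spread (hι : 3 ≤ Fintype.card ι) {i j : ι} (hij : i ≠ j) (c : R) (h : tv hij c ∈ N)
    {i' j' : ι} (hij' : i' ≠ j') : tv hij' c ∈ N := by
  obtain ⟨k, hk, hk'⟩ := exists_ne_ne hι i i'
  have h1 : tv hk.symm c ∈ N := by
    by_cases e : j = k
    · subst e; exact h
    · exact mem_of_TT hij hk.symm e c h
  have h2 : tv hk'.symm c ∈ N := by
    by_cases e : i = i'
    · subst e; exact h1
    · exact L2 hk.symm hk'.symm e c h1
  by_cases e : k = j'
  · subst e; exact h2
  · exact mem_of_TT hk'.symm hij' e c h2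

/-- Core divisibility. -/
lemma core (hι : 3 ≤ Fintype.card ι) (p : R)
    (hN : ∀ (i j : ι) (h : i ≠ j) (c : R), tv h c ∈ N → p ∣ c)
    (g : SpecialLinearGroup ι R) (hg : g ∈ N) (a b i : ι) (hb : b ≠ a) (hi : i ≠ a) :
    p ∣ g⁻¹.1 i a * g.1 b a := by
  obtain ⟨c, hca, hcb⟩ := exists_ne_ne hι a b
  set v : ι → R := g.1 *ᵥ Pi.single a 1 with hv
  have hvi : ∀ x, v x = g.1 x a := by intro x; simp [hv]
  set w : ι → R := Pi.single c (v b) - Pi.single b (v c) with hw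
  have hwa : w ⬝ᵥ Pi.single a 1 = 0 := by simp [hw, hb.symm, hca.symm]
  have hwv : w ⬝ᵥ v = 0 := by
    rw [hw, sub_dotProduct]; simp [mul_comm]
  set h := TT (Pi.single a 1) w hwa with hh
  set w' := w ᵥ* g.1 with hw'
  set u := g⁻¹.1 *ᵥ Pi.single a 1 with hu
  have hw'a : w' ⬝ᵥ Pi.single a 1 = 0 := by
    rw [hw', ← dotProduct_mulVec]; exact hwv
  have hw'u : w' ⬝ᵥ u = 0 := by
    rw [hw', hu, ← dotProduct_mulVec, mulVec_mulVec, mul_inv_coe, one_mulVec, hwa]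
  have hgc : g⁻¹ * h * g = TT u w' hw'u := TT_conj g _ _ _
  have hna : (-w) ⬝ᵥ Pi.single a 1 = 0 := by rw [neg_dotProduct, hwa, neg_zero]
  have hhinv : h⁻¹ = TT (Pi.single a 1) (-w) hna := by
    apply inv_eq_of_mul_eq_one_right
    rw [hh, TT_mul_left]
    apply Subtype.ext
    simp [TT_coe]
  set K := h⁻¹ * (g⁻¹ * h * g) with hK
  have hKN : K ∈ N := by
    have : h⁻¹ * g⁻¹ * h ∈ N := by
      simpa using (inferInstance : N.Normal).conj_mem _ (N.inv_mem hg) h⁻¹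
    have := N.mul_mem this hg
    simpa [hK, mul_assoc] using this
  have hK1 : K.1 = (TT (Pi.single a 1) (-w) hna).1 * (TT u w' hw'u).1 := by
    rw [hK, hgc, hhinv, val_mul]
  have hKa : K.1 *ᵥ Pi.single a 1 = Pi.single a 1 := by
    rw [hK1, ← mulVec_mulVec, TT_mulVec u, hw'a, zero_smul, add_zero, TT_mulVec, hna, zero_smul,
      add_zero]
  have hKia : K⁻¹.1 *ᵥ Pi.single a 1 = Pi.single a 1 := by
    conv_lhs => rw [← hKa]
    rw [mulVec_mulVec, inv_mul_coe, one_mulVec]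
  have hKi : (Pi.single i 1 : ι → R) ᵥ* K.1 = Pi.single i 1 + u i • w' := by
    rw [hK1, ← vecMul_vecMul, vecMul_TT, vecMul_TT]
    simp [hi, hi.symm]
  have hia : (Pi.single i 1 : ι → R) ⬝ᵥ Pi.single a 1 = 0 := by simp [hi, hi.symm]
  have hM : (TT (Pi.single a 1) (Pi.single i 1) hia)⁻¹ *
      (K⁻¹ * TT (Pi.single a 1) (Pi.single i 1) hia * K) ∈ N := by
    have := (inferInstance : N.Normal).conj_mem _ (N.inv_mem hKN)
      (TT (Pi.single a 1) (Pi.single i 1) hia)⁻¹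
    have := N.mul_mem this hKN
    simpa [mul_assoc] using this
  have huw : (u i • w') ⬝ᵥ Pi.single a 1 = 0 := by rw [smul_dotProduct, hw'a, smul_zero]
  have hMe : (TT (Pi.single a 1) (Pi.single i 1) hia)⁻¹ *
      (K⁻¹ * TT (Pi.single a 1) (Pi.single i 1) hia * K) = TT (Pi.single a 1) (u i • w') huw := by
    rw [inv_mul_eq_iff_eq_mul, TT_conj, TT_mul_left]
    exact TT_congr hKia hKi _
  rw [hMe] at hM
  have hdiv : ∀ j, p ∣ u i * w' j := by
    intro j
    by_cases hja : j = a
    · subst hja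
      have : w' j = 0 := by simpa using hw'a
      rw [this, mul_zero]; exact dvd_zero _
    · obtain ⟨k, hka, hkj⟩ := exists_ne_ne hι a j
      exact hN _ _ _ _ (L1 a j k _ huw hM (Ne.symm hja) hka.symm hkj.symm)
  have hwc : w = w' ᵥ* g⁻¹.1 := by rw [hw', vecMul_vecMul, mul_inv_coe, vecMul_one]
  have hwcc : w c = g.1 b a := by
    rw [hw, ← hvi]; simp [hcb]
  have hui : u i = g⁻¹.1 i a := by simp [hu]
  rw [← hui, ← hwcc, hwc]
  simp only [vecMul, dotProduct, Finset.mul_sum]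
  apply Finset.dvd_sum
  intro x _
  rw [← mul_assoc]
  exact (hdiv x).mul_right _

lemma offdiag (hι : 3 ≤ Fintype.card ι) (p : R) (hp : Prime p)
    (hN : ∀ (i j : ι) (h : i ≠ j) (c : R), tv h c ∈ N → p ∣ c)
    (g : SpecialLinearGroup ι R) (hg : g ∈ N) (b a : ι) (hb : b ≠ a) : p ∣ g.1 b a := by
  by_contra hcon
  have h1 : ∀ i, i ≠ a → p ∣ g⁻¹.1 i a := fun i hi =>
    (hp.dvd_or_dvd (core hι p hN g hg a b i hb hi)).resolve_right hcon
  have hsum : ∀ x, p ∣ (g.1 * g⁻¹.1) x a - g.1 x a * g⁻¹.1 a a := by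
    intro x
    rw [mul_apply, ← Finset.sum_erase_eq_sub (Finset.mem_univ a)]
    apply Finset.dvd_sum
    intro i hi
    exact (h1 i (Finset.ne_of_mem_erase hi)).mul_left _
  have h2 := hsum b
  have h3 := hsum a
  rw [mul_inv_coe] at h2 h3
  rw [one_apply_ne hb, zero_sub, dvd_neg] at h2
  have h4 : p ∣ g⁻¹.1 a a := (hp.dvd_or_dvd h2).resolve_left hcon
  rw [one_apply_eq] at h3
  have := dvd_add h3 (h4.mul_left (g.1 a a))
  rw [sub_add_cancel] at this
  exact hp.not_isUnit (isUnit_of_dvd_one this)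

lemma diagdiff (hι : 3 ≤ Fintype.card ι) (p : R) (hp : Prime p)
    (hN : ∀ (i j : ι) (h : i ≠ j) (c : R), tv h c ∈ N → p ∣ c)
    (g : SpecialLinearGroup ι R) (hg : g ∈ N) (i j : ι) : p ∣ g.1 i i - g.1 j j := by
  by_cases hij : i = j
  · subst hij; simp
  have h1 : tv hij (1 : R) * g * (tv hij (1 : R))⁻¹ ∈ N :=
    (inferInstance : N.Normal).conj_mem _ hg _
  have h2 := offdiag hι p hp hN _ h1 i j hij
  have h3 := offdiag hι p hp hN g hg i j hij
  have h4 := offdiag hι p hp hN g hg j i (Ne.symm hij)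
  rw [show (tv hij (1 : R))⁻¹ = tv hij (-1) from SpecialLinearGroup.transvection_inv hij 1] at h2
  have e : (tv hij (1 : R) * g * tv hij (-1 : R)).1 i j
      = g.1 i j + g.1 j j - g.1 i i - g.1 j i := by
    change (Matrix.transvection i j (1 : R) * g.1 * Matrix.transvection i j (-1 : R)) i j = _
    simp
    ring
  rw [e] at h2
  have : g.1 i i - g.1 j j = g.1 i j - g.1 j i - (g.1 i j + g.1 j j - g.1 i i - g.1 j i) := by ring
  rw [this]
  exact dvd_sub (dvd_sub h3 h4) h2

end sandwich
section count

lemma pow_ineq (p : ℕ) (hp : 2 ≤ p) (k : ℕ) : (p - 1) * (2 ^ k - 1) ≤ p ^ k - 1 := by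
  obtain ⟨q, rfl⟩ := Nat.exists_eq_add_of_le hp
  rw [Nat.mul_sub_one]
  have h1 : 1 ≤ (2 + q) ^ k := Nat.one_le_pow _ _ (by omega)
  suffices (2 + q - 1) * 2 ^ k + 1 ≤ (2 + q) ^ k + (2 + q - 1) by omega
  have e : 2 + q - 1 = q + 1 := by omega
  rw [e]
  clear h1
  induction k with
  | zero => simp
  | succ k ih =>
    have h1 : 1 ≤ (2 + q) ^ k := Nat.one_le_pow _ _ (by omega)
    rw [pow_succ, pow_succ]
    nlinarith

lemma prod_ineq (p n : ℕ) (hp : 2 ≤ p) :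
    (p - 1) ^ n * ∏ i : Fin n, (2 ^ n - 2 ^ (i : ℕ)) ≤ ∏ i : Fin n, (p ^ n - p ^ (i : ℕ)) := by
  have : (p - 1) ^ n = ∏ i : Fin n, (p - 1) := by simp
  rw [this, ← Finset.prod_mul_distrib]
  apply Finset.prod_le_prod'
  intro i _
  have key : ∀ q : ℕ, q ^ n - q ^ (i : ℕ) = q ^ (i : ℕ) * (q ^ (n - i) - 1) := by
    intro q
    rw [Nat.mul_sub_one, ← pow_add]
    congr 2
    omega
  rw [key, key]
  calc (p - 1) * (2 ^ (i : ℕ) * (2 ^ (n - i) - 1))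
      = 2 ^ (i : ℕ) * ((p - 1) * (2 ^ (n - i) - 1)) := by ring
    _ ≤ _ := Nat.mul_le_mul (Nat.pow_le_pow_left hp _) (pow_ineq p hp _)

variable (p n : ℕ) [Fact p.Prime]

lemma card_GL_le : Nat.card (GL (Fin n) (ZMod p)) ≤
    Nat.card (SpecialLinearGroup (Fin n) (ZMod p)) * (p - 1) := by
  let d : GL (Fin n) (ZMod p) →* (ZMod p)ˣ := GeneralLinearGroup.det
  rw [← Subgroup.card_mul_index d.ker, Subgroup.index_ker]
  apply Nat.mul_le_mul
  · apply Nat.card_le_card_of_injective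
      (fun g : d.ker => (⟨g.1.1, by
        have := congrArg Units.val (MonoidHom.mem_ker.1 g.2)
        simpa [d] using this⟩ : SpecialLinearGroup (Fin n) (ZMod p)))
    intro a b h
    exact Subtype.ext (Units.ext (congrArg Subtype.val h))
  · refine (Subgroup.card_le_card_group _).trans ?_
    rw [Nat.card_eq_fintype_card, ZMod.card_units]

lemma card_center_le (hn : 0 < n) :
    Nat.card (Subgroup.center (SpecialLinearGroup (Fin n) (ZMod p))) ≤ p - 1 := by
  rw [Nat.card_congr (SpecialLinearGroup.center_equiv_rootsOfUnity' (⟨0, hn⟩ : Fin n)).toEquiv]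
  refine (Subgroup.card_le_card_group _).trans ?_
  rw [Nat.card_eq_fintype_card, ZMod.card_units]

lemma card_PSL2_le : Nat.card (SpecialLinearGroup (Fin n) (ZMod 2) ⧸
        Subgroup.center (SpecialLinearGroup (Fin n) (ZMod 2))) ≤
    ∏ i : Fin n, (2 ^ n - 2 ^ (i : ℕ)) := by
  have h := card_GL_field (𝔽 := ZMod 2) n
  rw [ZMod.card] at h
  rw [← h]
  refine (Nat.card_le_card_of_surjective _ (QuotientGroup.mk_surjective)).trans ?_
  apply Nat.card_le_card_of_injective
    (SpecialLinearGroup.toGL : SpecialLinearGroup (Fin n) (ZMod 2) →* GL (Fin n) (ZMod 2))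
  intro a b h
  exact Subtype.ext (congrArg Units.val h)

/-- Final count. -/
lemma count (hn : 3 ≤ n) (C : Subgroup (SpecialLinearGroup (Fin n) (ZMod p)))
    (hC : C ≤ Subgroup.center _) (h : ℕ) (hi : C.index ≤ h) :
    Nat.card (SpecialLinearGroup (Fin n) (ZMod 2) ⧸
        Subgroup.center (SpecialLinearGroup (Fin n) (ZMod 2))) ≤ h := by
  have hp : 2 ≤ p := (Fact.out : p.Prime).two_le
  refine (card_PSL2_le n).trans ?_
  have h1 := card_GL_le p n
  have h2 := card_GL_field (𝔽 := ZMod p) n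
  rw [ZMod.card] at h2
  have h3 := prod_ineq p n hp
  have h4 : Nat.card C ≤ p - 1 :=
    (Subgroup.card_le_of_le hC).trans (card_center_le p n (by omega))
  rw [h2, ← Subgroup.card_mul_index C] at h1
  have h5 : Nat.card C * C.index ≤ (p - 1) * h := Nat.mul_le_mul h4 hi
  have h6 : (p - 1) ^ 2 ≤ (p - 1) ^ n := Nat.pow_le_pow_right (by omega) (by omega)
  have h7 : 0 < (p - 1) ^ 2 := Nat.pow_pos (by omega)
  apply Nat.le_of_mul_le_mul_left _ h7
  calc _ ≤ _ := Nat.mul_le_mul_right _ h6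
    _ ≤ _ := h3
    _ ≤ _ := h1
    _ ≤ (p - 1) * h * (p - 1) := Nat.mul_le_mul_right _ h5
    _ = _ := by ring
end count
end SLQ

namespace SLQ

theorem main1 {n : ℕ} (hn : 3 ≤ n)
    (H : Type) [Group H] [Finite H] (f : SpecialLinearGroup (Fin n) ℤ →* H)
    (hf : Function.Surjective f) (hnt : Nontrivial H) :
    Nat.card (SpecialLinearGroup (Fin n) (ZMod 2) ⧸
        Subgroup.center (SpecialLinearGroup (Fin n) (ZMod 2))) ≤ Nat.card H := by
  have hι : 3 ≤ Fintype.card (Fin n) := by simpa using hn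
  -- the level ideal
  let I : AddSubgroup ℤ :=
    { carrier := {c | ∀ (i j : Fin n) (h : i ≠ j), tv h c ∈ f.ker}
      zero_mem' := by
        intro i j h
        rw [show tv h (0 : ℤ) = 1 from SpecialLinearGroup.transvection_coeff_zero h]
        exact one_mem _
      add_mem' := by
        intro a b ha hb i j h
        rw [show tv h (a + b) = tv h a * tv h b from SpecialLinearGroup.transvection_add h a b]
        exact mul_mem (ha i j h) (hb i j h)
      neg_mem' := by
        intro a ha i j h
        rw [show tv h (-a) = (tv h a)⁻¹ from (SpecialLinearGroup.transvection_inv h a).symm]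
        exact inv_mem (ha i j h) }
  obtain ⟨m, hm⟩ := Int.subgroup_cyclic I
  have hI : ∀ c, c ∈ I ↔ m ∣ c := by
    intro c
    rw [hm, AddSubgroup.mem_closure_singleton]
    constructor
    · rintro ⟨k, rfl⟩; simp
    · rintro ⟨k, rfl⟩; exact ⟨k, by simp [mul_comm]⟩
  have hm1 : m.natAbs ≠ 1 := by
    intro h1
    have hall : ∀ c, c ∈ I := by
      intro c
      rw [hI]
      exact (Int.isUnit_iff_natAbs_eq.2 h1).dvd
    have htop : f.ker = ⊤ := gen_int (fun i j h c => hall c i j h)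
    obtain ⟨x, hx⟩ := exists_ne (1 : H)
    obtain ⟨g, rfl⟩ := hf x
    exact hx (MonoidHom.mem_ker.1 (htop ▸ Subgroup.mem_top g))
  obtain ⟨p, hp, hpm⟩ := Nat.exists_prime_and_dvd hm1
  haveI : Fact p.Prime := ⟨hp⟩
  have hN : ∀ (i j : Fin n) (h : i ≠ j) (c : ℤ), tv h c ∈ f.ker → (p : ℤ) ∣ c := by
    intro i j h c hc
    have : c ∈ I := fun i' j' h' => spread hι h c hc h'
    exact (Int.natCast_dvd.2 hpm).trans ((hI c).1 this)
  have hpp : Prime (p : ℤ) := Nat.prime_iff_prime_int.1 hp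
  let φ : SpecialLinearGroup (Fin n) ℤ →* SpecialLinearGroup (Fin n) (ZMod p) :=
    SpecialLinearGroup.map (Int.castRingHom (ZMod p))
  have hφ : ∀ g i j, (φ g).1 i j = ((g.1 i j : ℤ) : ZMod p) := fun g i j => rfl
  have hsurj : Function.Surjective φ := by
    rw [← MonoidHom.range_eq_top]
    apply gen_field
    intro i j h c
    obtain ⟨z, rfl⟩ := ZMod.intCast_surjective c
    refine ⟨tv h z, ?_⟩
    apply Subtype.ext
    ext a b
    rw [hφ]
    change (((1 + single i j z : Matrix (Fin n) (Fin n) ℤ) a b : ℤ) : ZMod p) =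
      (1 + single i j (z : ZMod p) : Matrix (Fin n) (Fin n) (ZMod p)) a b
    rw [Matrix.add_apply, Matrix.add_apply, Matrix.one_apply, Matrix.one_apply,
      Matrix.single_apply, Matrix.single_apply]
    push_cast
    rfl
  apply count p n hn (f.ker.map φ)
  · rintro _ ⟨g, hg, rfl⟩
    rw [Matrix.SpecialLinearGroup.mem_center_iff]
    let i0 : Fin n := ⟨0, by omega⟩
    have e : scalar (Fin n) ((φ g).1 i0 i0) = (φ g).1 := by
      ext a b
      rw [scalar_apply]
      by_cases hab : a = b
      · subst hab
        rw [diagonal_apply_eq, hφ, hφ, ← sub_eq_zero, ← Int.cast_sub,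
          ZMod.intCast_zmod_eq_zero_iff_dvd]
        exact diagdiff hι _ hpp hN g hg _ _
      · rw [diagonal_apply_ne _ hab, hφ, eq_comm, ZMod.intCast_zmod_eq_zero_iff_dvd]
        exact offdiag hι _ hpp hN g hg _ _ hab
    refine ⟨(φ g).1 i0 i0, ?_, e⟩
    have hd := (φ g).2
    rw [← e] at hd
    simpa using hd
  · have h1 : f.ker.index = Nat.card H := by
      rw [Subgroup.index_ker, MonoidHom.range_eq_top.2 hf, Subgroup.card_top]
    rw [← h1]
    exact Nat.le_of_dvd (by rw [h1]; exact Nat.card_pos) (Subgroup.index_map_dvd _ hsurj)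

end SLQ

/-- For `n ≥ 3`, every nontrivial finite quotient of `SL_n(ℤ)` has cardinality at least
`|PSL_n(ℤ/2ℤ)|`; in particular any homomorphism from `SL_n(ℤ)` to a finite group of order
less than `|PSL_n(ℤ/2ℤ)|` is trivial. -/
theorem sl_smallest_finite_quotient {n : ℕ} (hn : 3 ≤ n)
    (H : Type) [Group H] [Fintype H] (f : SpecialLinearGroup (Fin n) ℤ →* H) :
    (Function.Surjective f → Nontrivial H →
      Nat.card (SpecialLinearGroup (Fin n) (ZMod 2) ⧸
        Subgroup.center (SpecialLinearGroup (Fin n) (ZMod 2))) ≤ Fintype.card H) ∧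
    (Fintype.card H <
        Nat.card (SpecialLinearGroup (Fin n) (ZMod 2) ⧸
          Subgroup.center (SpecialLinearGroup (Fin n) (ZMod 2))) →
      ∀ g, f g = 1) := by
  have key := fun (hs : Function.Surjective f) (hnt : Nontrivial H) =>
    (SLQ.main1 hn H f hs hnt).trans_eq Nat.card_eq_fintype_card
  refine ⟨key, ?_⟩
  intro hlt
  by_contra hcon
  push Not at hcon
  obtain ⟨g, hg⟩ := hcon
  have hnt : Nontrivial f.range :=
    ⟨⟨f g, g, rfl⟩, 1, fun h => hg (congrArg Subtype.val h)⟩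
  have h1 := SLQ.main1 hn f.range f.rangeRestrict f.rangeRestrict_surjective hnt
  have h2 := Subgroup.card_le_card_group f.range
  rw [Nat.card_eq_fintype_card (α := H)] at h2
  omega
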